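/- arXiv:1712.04890 — 2 statements merged into one kernel-verified Lean document; each statement's English description precedes it below -/
import Mathlib

section
/- For any universe u, axioms (1)–(3) for Type u hold together if and only if naive univalence holds for Type u, i.e., there exists a term ua : ∀ (A B : Type u), (A ≃ B) → A = B. -/
universe u

def isContr (A : Type u) : Prop := ∃ a₀ : A, ∀ a : A, a₀ = a

theorem isContr_sigma_eq_right {A B : Type u} (f : A → B) (a : A) :
    isContr (Σ b : B, ULift.{u} (PLift (f a = b))) :=
  ⟨⟨f a, ⟨⟨rfl⟩⟩⟩, by rintro ⟨_, ⟨⟨rfl⟩⟩⟩; rfl⟩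

theorem isContr_sigma_eq_left {A B : Type u} (e : A ≃ B) (b : B) :
    isContr (Σ a : A, ULift.{u} (PLift (e a = b))) := by
  obtain ⟨a, rfl⟩ := e.surjective b
  refine ⟨⟨a, ⟨⟨rfl⟩⟩⟩, ?_⟩
  rintro ⟨a', ⟨⟨h⟩⟩⟩
  obtain rfl := e.injective h
  rfl

theorem axioms123_iff_naive_univalence :
    ((∀ A : Type u, A = (Σ _ : A, PUnit.{u+1})) ∧
     (∀ (A B : Type u) (C : A → B → Type u),
       (Σ a : A, Σ b : B, C a b) = (Σ b : B, Σ a : A, C a b)) ∧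
     (∀ A : Type u, isContr A → A = PUnit.{u+1})) ↔
    (∀ A B : Type u, (A ≃ B) → A = B) := by
  constructor
  · rintro ⟨unit, flip, contract⟩ A B e
    calc
      A = (Σ _ : A, PUnit.{u+1}) := unit A
      _ = (Σ a : A, Σ b : B, ULift.{u} (PLift (e a = b))) :=
        congrArg (Sigma (α := A))
          (funext fun a => (contract _ (isContr_sigma_eq_right e a)).symm)
      _ = (Σ b : B, Σ a : A, ULift.{u} (PLift (e a = b))) := flip A B _
      _ = (Σ _ : B, PUnit.{u+1}) :=
        congrArg (Sigma (α := B))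
          (funext fun b => contract _ (isContr_sigma_eq_left e b))
      _ = B := (unit B).symm
  · intro ua
    refine ⟨fun A => ua _ _ (Equiv.sigmaUnique A fun _ => PUnit.{u+1}).symm,
      fun A B C => ua _ _ ⟨fun x => ⟨x.2.1, x.1, x.2.2⟩,
        fun x => ⟨x.2.1, x.1, x.2.2⟩, fun _ => rfl, fun _ => rfl⟩, ?_⟩
    rintro A ⟨a₀, h⟩
    have : Unique A := ⟨⟨a₀⟩, fun a => (h a).symm⟩
    exact ua _ _ (Equiv.equivPUnit A)
end

section
/- Given terms unit : ∀ (A : Type u), A = (Σ _ : A, PUnit), flip : ∀ (A B : Type u) (C : A → B → Type u), (Σ a : A, Σ b : B, C a b) = (Σ b : B, Σ a : A, C a b), and contract : ∀ (A : Type u), isContr A → A = PUnit, there exists a term ua : ∀ (A B : Type u), (A ≃ B) → A = B. -/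
universe u

theorem axioms123_imply_naive_univalence
    (unit : ∀ A : Type u, A = (Σ _ : A, PUnit.{u+1}))
    (flip : ∀ (A B : Type u) (C : A → B → Type u),
      (Σ a : A, Σ b : B, C a b) = (Σ b : B, Σ a : A, C a b))
    (contract : ∀ A : Type u, isContr A → A = PUnit.{u+1}) :
    ∀ A B : Type u, (A ≃ B) → A = B := by
  intro A B e
  have left_contr : ∀ a : A, isContr (Σ b : B, ULift.{u} (PLift (e a = b))) := by
    refine fun a => ⟨⟨e a, ⟨⟨rfl⟩⟩⟩, ?_⟩
    rintro ⟨b, ⟨⟨rfl⟩⟩⟩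
    rfl
  have right_contr : ∀ b : B, isContr (Σ a : A, ULift.{u} (PLift (e a = b))) := by
    intro b
    obtain ⟨a₀, rfl⟩ := e.surjective b
    refine ⟨⟨a₀, ⟨⟨rfl⟩⟩⟩, ?_⟩
    rintro ⟨a, ⟨⟨h⟩⟩⟩
    obtain rfl := e.injective h
    rfl
  calc
    A = (Σ _ : A, PUnit.{u+1}) := unit A
    _ = (Σ a : A, Σ b : B, ULift.{u} (PLift (e a = b))) :=
      congrArg Sigma (funext fun a => (contract _ (left_contr a)).symm)
    _ = (Σ b : B, Σ a : A, ULift.{u} (PLift (e a = b))) := flip A B _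
    _ = (Σ _ : B, PUnit.{u+1}) := congrArg Sigma (funext fun b => contract _ (right_contr b))
    _ = B := (unit B).symm
end
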